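/- arXiv:2511.03362 — 2 statements merged into one kernel-verified Lean document; each statement's English description precedes it below -/
import Mathlib

section
/- Let N₀ be a positive integer and let i₀, j₀, k₀ be positive integers satisfying i₀ + j₀ + k₀ = N₀ and 2 ≤ i₀ ≤ j₀ ≤ k₀ ≤ N₀/2 − 1. Set I = 2πi₀/N₀, J = 2πj₀/N₀, K = 2πk₀/N₀. Then the series ∑_{l=1}^{∞} ((2 + (−1)^l)/l) (sin(lI) + sin(lJ) + sin(lK)) converges to 0; that is, the partial sums ∑_{l=1}^{M} ((2 + (−1)^l)/l)(sin(lI) + sin(lJ) + sin(lK)) tend to 0 as M → ∞. -/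
open Real Filter

lemma aux_sin (x : ℝ) (h0 : 0 < x) (h1 : x < 2 * π) :
    Tendsto (fun M : ℕ => ∑ l ∈ Finset.Icc 1 M, Real.sin (l * x) / l) atTop
      (nhds ((π - x) / 2)) := by
  set w : ℂ := Complex.exp (x * Complex.I) with hw
  have hs : 0 < Real.sin (x / 2) := Real.sin_pos_of_pos_of_lt_pi (by linarith) (by linarith)
  have hfac : 1 - w = ((2 * Real.sin (x / 2) : ℝ) : ℂ) *
      (Complex.cos (((x - π) / 2 : ℝ) : ℂ) + Complex.sin (((x - π) / 2 : ℝ) : ℂ) * Complex.I) := by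
    have e1 : Real.cos ((x - π) / 2) = Real.sin (x / 2) := by
      rw [show (x - π) / 2 = x / 2 - π / 2 by ring, Real.cos_sub_pi_div_two]
    have e2 : Real.sin ((x - π) / 2) = - Real.cos (x / 2) := by
      rw [show (x - π) / 2 = x / 2 - π / 2 by ring, Real.sin_sub_pi_div_two]
    have e3 : Real.cos x = 1 - 2 * Real.sin (x / 2) ^ 2 := by
      have := Real.cos_sq_add_sin_sq (x / 2)
      have h := Real.cos_two_mul (x / 2)
      rw [show 2 * (x / 2) = x by ring] at h
      linarith
    have e4 : Real.sin x = 2 * Real.sin (x / 2) * Real.cos (x / 2) := by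
      rw [← Real.sin_two_mul]; congr 1; ring
    rw [hw, Complex.exp_mul_I, ← Complex.ofReal_cos, ← Complex.ofReal_sin, ← Complex.ofReal_cos,
      ← Complex.ofReal_sin, e1, e2, e3, e4]
    push_cast
    ring
  have harg : Complex.arg (1 - w) = (x - π) / 2 := by
    rw [hfac]
    exact Complex.arg_mul_cos_add_sin_mul_I (by positivity) ⟨by linarith, by linarith⟩
  have hne : 1 - w ≠ 0 := by
    intro h
    rw [h, Complex.arg_zero] at harg
    have hx : x = π := by linarith
    rw [hw, hx, Complex.exp_pi_mul_I] at h
    norm_num at h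
  have hslit : 1 - w ∈ Complex.slitPlane := by
    rw [Complex.mem_slitPlane_iff_arg]
    exact ⟨by rw [harg]; intro h; linarith, hne⟩
  have hnw : ‖w‖ = 1 := Complex.norm_exp_ofReal_mul_I x
  have hcau : CauchySeq fun n : ℕ => ∑ i ∈ Finset.range n, (1 / ((i : ℝ) + 1)) • w ^ (i + 1) := by
    refine Antitone.cauchySeq_series_mul_of_tendsto_zero_of_bounded (b := 2 / ‖1 - w‖) ?_
      tendsto_one_div_add_atTop_nhds_zero_nat ?_
    · intro a b hab
      have : (a : ℝ) ≤ b := by exact_mod_cast hab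
      dsimp only
      gcongr
    · intro n
      have : ∑ i ∈ Finset.range n, w ^ (i + 1) = w * (1 - w ^ n) / (1 - w) := by
        rw [eq_div_iff hne, ← mul_neg_geom_sum w n, Finset.mul_sum, Finset.mul_sum, Finset.sum_mul]
        exact Finset.sum_congr rfl fun i _ => by ring
      rw [this, norm_div, norm_mul, hnw, one_mul]
      gcongr
      calc ‖1 - w ^ n‖ ≤ ‖(1 : ℂ)‖ + ‖w ^ n‖ := norm_sub_le _ _
        _ = 2 := by rw [norm_pow, hnw]; norm_num
  obtain ⟨L, hL⟩ := cauchySeq_tendsto_of_complete hcau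
  have hL' : Tendsto (fun n : ℕ => ∑ i ∈ Finset.range n, w ^ i / (i : ℂ)) atTop (nhds L) := by
    rw [← tendsto_add_atTop_iff_nat 1]
    refine hL.congr fun n => ?_
    rw [Finset.sum_range_succ']
    simp only [Nat.cast_zero, div_zero, add_zero]
    refine Finset.sum_congr rfl fun i _ => ?_
    rw [Complex.real_smul]
    push_cast
    ring
  have hab := Complex.tendsto_tsum_powerSeries_nhdsWithin_lt hL'
  rw [tendsto_map'_iff] at hab
  have hlog : Tendsto (fun r : ℝ => -Complex.log (1 - r * w)) (nhdsWithin 1 (Set.Iio 1))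
      (nhds (-Complex.log (1 - w))) := by
    have : ContinuousAt (fun r : ℝ => -Complex.log (1 - r * w)) 1 := by
      refine (ContinuousAt.clog (by fun_prop) ?_).neg
      simpa using hslit
    have h := this.tendsto.mono_left (nhdsWithin_le_nhds (s := Set.Iio 1))
    simpa using h
  have hLeq : L = -Complex.log (1 - w) := by
    refine tendsto_nhds_unique hab (hlog.congr' ?_)
    filter_upwards [Ioo_mem_nhdsLT (show (0 : ℝ) < 1 by norm_num)] with r hr
    have hz : ‖(r : ℂ) * w‖ < 1 := by
      rw [norm_mul, hnw, mul_one, Complex.norm_real, Real.norm_of_nonneg hr.1.le]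
      exact hr.2
    rw [← (Complex.hasSum_taylorSeries_neg_log hz).tsum_eq]
    refine tsum_congr fun n => ?_
    rw [mul_pow]
    ring
  have him := (Complex.continuous_im.tendsto L).comp hL'
  have hLim : L.im = (π - x) / 2 := by
    rw [hLeq, Complex.neg_im, Complex.log_im, harg]; ring
  rw [hLim] at him
  rw [← tendsto_add_atTop_iff_nat 1] at him
  refine him.congr fun n => ?_
  simp only [Function.comp]
  rw [Complex.im_sum, Finset.sum_range_succ']
  simp only [Nat.cast_zero, div_zero, Complex.zero_im, add_zero]
  rw [Finset.range_eq_Ico, Finset.sum_Ico_add' (fun i : ℕ => (w ^ i / (i : ℂ)).im) 0 n 1]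
  refine Finset.sum_congr (by ext; simp <;> omega) fun i _ => ?_
  rw [← Complex.ofReal_natCast, Complex.div_ofReal_im, hw, ← Complex.exp_nat_mul,
    show (i : ℂ) * (x * Complex.I) = ((i * x : ℝ) : ℂ) * Complex.I by push_cast; ring,
    Complex.exp_ofReal_mul_I_im]

lemma aux_one (x : ℝ) (h0 : 0 < x) (h1 : x < π) :
    Tendsto (fun M : ℕ => ∑ l ∈ Finset.Icc 1 M, ((2 + (-1 : ℝ) ^ l) / l) * Real.sin (l * x)) atTop
      (nhds (π - 3 * x / 2)) := by
  have hA := (aux_sin x h0 (by linarith)).const_mul 2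
  have hB := aux_sin (x + π) (by linarith) (by linarith)
  have h := hA.add hB
  rw [show π - 3 * x / 2 = 2 * ((π - x) / 2) + (π - (x + π)) / 2 by ring]
  refine h.congr fun M => ?_
  rw [Finset.mul_sum, ← Finset.sum_add_distrib]
  refine Finset.sum_congr rfl fun l _ => ?_
  rw [mul_add, Real.sin_add_nat_mul_pi]
  ring

/-- Theorem 1 of the paper: the coupling constants `a_l = (2 + (−1)^l)/l` satisfy the
umklapp-free symmetry condition in the infinite-lattice limit. -/
theorem stmt_0 (N₀ i₀ j₀ k₀ : ℕ) (hN₀ : 0 < N₀) (hi₀ : 0 < i₀) (hj₀ : 0 < j₀)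
    (hk₀ : 0 < k₀) (hsum : i₀ + j₀ + k₀ = N₀) (h2 : 2 ≤ i₀) (hij : i₀ ≤ j₀)
    (hjk : j₀ ≤ k₀) (hk : (k₀ : ℝ) ≤ (N₀ : ℝ) / 2 - 1) :
    Tendsto
      (fun M : ℕ => ∑ l ∈ Finset.Icc 1 M,
        ((2 + (-1 : ℝ) ^ l) / l) *
          (Real.sin (l * (2 * π * i₀ / N₀)) + Real.sin (l * (2 * π * j₀ / N₀)) +
            Real.sin (l * (2 * π * k₀ / N₀))))
      atTop (nhds 0) := by
  have hN : (0 : ℝ) < N₀ := by exact_mod_cast hN₀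
  have key : ∀ m : ℕ, 0 < m → m ≤ k₀ → 0 < 2 * π * m / N₀ ∧ 2 * π * m / N₀ < π := by
    intro m hm hmk
    have hm' : (0 : ℝ) < m := by exact_mod_cast hm
    have hmk' : (m : ℝ) ≤ k₀ := by exact_mod_cast hmk
    refine ⟨by positivity, ?_⟩
    rw [div_lt_iff₀ hN]
    nlinarith [Real.pi_pos]
  have hI := key i₀ hi₀ (hij.trans hjk)
  have hJ := key j₀ hj₀ hjk
  have hK := key k₀ hk₀ le_rfl
  have h := ((aux_one _ hI.1 hI.2).add (aux_one _ hJ.1 hJ.2)).add (aux_one _ hK.1 hK.2)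
  have hs : (i₀ : ℝ) + j₀ + k₀ = N₀ := by exact_mod_cast hsum
  have hz : π - 3 * (2 * π * i₀ / N₀) / 2 + (π - 3 * (2 * π * j₀ / N₀) / 2) +
      (π - 3 * (2 * π * k₀ / N₀) / 2) = 0 := by
    field_simp
    rw [← hs]
    ring
  rw [hz] at h
  refine h.congr fun M => ?_
  rw [← Finset.sum_add_distrib, ← Finset.sum_add_distrib]
  exact Finset.sum_congr rfl fun l _ => by ring
end

section
/- Let N be an even integer with N ≥ 6 and let i, j, k be integers with 2 ≤ i ≤ j ≤ k ≤ N/2 − 1 and i + j + k = N. Then ∑_{l=1}^{N/2−1} (−1)^l · (π(2 + (−1)^l)/(N·tan(πl/N))) · sin(πli/N) · sin(πlj/N) · sin(πlk/N) = 0. -/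
open Real

lemma aux_tel (t : ℝ) (n : ℕ) : 2 * sin (t/2) * ∑ l ∈ Finset.Icc 1 n, cos (l * t)
    = sin ((n + 1/2) * t) - sin (t/2) := by
  induction n with
  | zero => simp; ring_nf
  | succ n ih =>
    rw [Finset.sum_Icc_succ_top (by omega), mul_add, ih]
    have h1 : ((n:ℝ) + 1/2) * t = ((n+1 : ℕ):ℝ) * t - t/2 := by push_cast; ring
    have h2 : (((n+1 : ℕ):ℝ) + 1/2) * t = ((n+1 : ℕ):ℝ) * t + t/2 := by ring
    rw [h1, h2, sin_sub, sin_add]; ring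

lemma aux_C (m k : ℕ) (hk : 0 < k) (hk2 : k < 2 * (m+1)) :
    ∑ l ∈ Finset.Icc 1 m, cos (l * (π * k / (m+1))) = -(1 + (-1:ℝ)^k)/2 := by
  have h := aux_tel (π * k / (m+1)) m
  have hm : (0:ℝ) < m + 1 := by positivity
  have hk' : (0:ℝ) < k := by exact_mod_cast hk
  have hk2' : (k:ℝ) < 2 * (m+1) := by exact_mod_cast hk2
  have hs : 0 < sin (π * k / (m+1) / 2) := by
    apply sin_pos_of_pos_of_lt_pi
    · have := pi_pos; positivity
    · rw [div_div, div_lt_iff₀ (by positivity)]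
      nlinarith [pi_pos]
  have e : ((m:ℝ) + 1/2) * (π * k / (m+1)) = k * π - π * k / (m+1) / 2 := by
    field_simp; ring
  rw [e, sin_nat_mul_pi_sub] at h
  apply mul_left_cancel₀ (ne_of_gt (mul_pos two_pos hs))
  rw [h]; ring

lemma cos_shift (m k l : ℕ) : cos (l * (π * (k + (m+1) : ℕ) / (m+1))) =
    (-1:ℝ)^l * cos (l * (π * k / (m+1))) := by
  have hm : (0:ℝ) < m + 1 := by positivity
  have : (l:ℝ) * (π * (k + (m+1) : ℕ) / (m+1)) = l * (π * k / (m+1)) + l * π := by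
    push_cast; field_simp
  rw [this, cos_add_nat_mul_pi]

/-- the cosine sum -/
noncomputable def gsum (m k : ℕ) : ℝ :=
  ∑ l ∈ Finset.Icc 1 m, (2 + (-1:ℝ)^l) * cos (l * (π * k / (m+1)))

lemma gsum_pos (m k : ℕ) (hk : 0 < k) (hk2 : k < m + 1) :
    gsum m k = -(1 + (-1:ℝ)^k) - (1 + (-1:ℝ)^(k+(m+1)))/2 := by
  have h1 := aux_C m k hk (by omega)
  have h2 := aux_C m (k+(m+1)) (by omega) (by omega)
  simp only [cos_shift] at h2
  simp only [gsum, add_mul, Finset.sum_add_distrib, ← Finset.mul_sum]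
  rw [h1, h2]; ring

lemma gsum_zero (m : ℕ) : gsum m 0 = 2 * m - (1 + (-1:ℝ)^(m+1))/2 := by
  have h2 := aux_C m (0+(m+1)) (by omega) (by omega)
  simp only [cos_shift] at h2
  simp only [gsum, add_mul, Finset.sum_add_distrib, ← Finset.mul_sum]
  rw [h2]; simp; ring

/-- the cotangent sum -/
noncomputable def fsum (m k : ℕ) : ℝ :=
  ∑ l ∈ Finset.Icc 1 m, (2 + (-1:ℝ)^l) / tan (l * (π / (2*(m+1)))) * sin (l * (π * k / (m+1)))

lemma fsum_succ (m k : ℕ) : fsum m (k+1) = fsum m k + gsum m k + gsum m (k+1) := by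
  simp only [fsum, gsum, ← Finset.sum_add_distrib]
  refine Finset.sum_congr rfl fun l hl => ?_
  rw [Finset.mem_Icc] at hl
  have hm : (0:ℝ) < m + 1 := by positivity
  have hl1 : (0:ℝ) < l := by exact_mod_cast hl.1
  have hl2 : (l:ℝ) < m + 1 := by exact_mod_cast Nat.lt_succ_of_le hl.2
  set x := (l:ℝ) * (π / (2*(m+1))) with hx
  have hx0 : 0 < x := by have := pi_pos; positivity
  have hx1 : x < π / 2 := by
    rw [hx, ← mul_div_assoc, div_lt_div_iff₀ (by positivity) two_pos]
    nlinarith [pi_pos]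
  have hs := sin_pos_of_pos_of_lt_pi hx0 (by linarith)
  have hc := cos_pos_of_mem_Ioo (x := x) ⟨by linarith, hx1⟩
  obtain ⟨y, hy⟩ : ∃ y, y = (l:ℝ) * (π * k / (m+1)) + x := ⟨_, rfl⟩
  have e1 : (l:ℝ) * (π * k / (m+1)) = y - x := by rw [hy]; ring
  have e2 : (l:ℝ) * (π * (k+1 : ℕ) / (m+1)) = y + x := by
    rw [hy, hx]; push_cast; field_simp; ring
  rw [e1, e2, tan_eq_sin_div_cos, sin_add, sin_sub, cos_add, cos_sub]
  field_simp
  ring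

lemma fsum_eq (m k : ℕ) (hk : 0 < k) (hk2 : k < m + 1) : fsum m k = 2 * (m+1) - 3 * k := by
  induction k, hk using Nat.le_induction with
  | base =>
    have h0 : fsum m 0 = 0 := by simp [fsum]
    have := fsum_succ m 0
    rw [h0, gsum_zero, gsum_pos m (0+1) (by omega) (by omega)] at this
    simp only [Nat.succ_eq_add_one, zero_add] at *
    rw [this]; push_cast; ring
  | succ k hk ih =>
    rw [fsum_succ, ih (by omega), gsum_pos m k (by omega) (by omega),
      gsum_pos m (k+1) (by omega) (by omega)]
    push_cast; ring

lemma triple (a b c : ℝ) (l : ℕ) (h : a + b + c = l * π) :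
    sin a * sin b * sin c = -(-1:ℝ)^l / 4 * (sin (2*a) + sin (2*b) + sin (2*c)) := by
  have hc : c = l * π - (a + b) := by linarith
  have h1 : sin c = -((-1:ℝ)^l * sin (-(-(a+b)))) * (-1) * (-1) := by
    rw [hc, sin_nat_mul_pi_sub]; ring_nf
  have h2 : cos c = (-1:ℝ)^l * cos (a+b) := by rw [hc, cos_nat_mul_pi_sub]
  have hp : ((-1:ℝ)^l)*((-1:ℝ)^l) = 1 := by rw [← mul_pow]; simp
  have h3 : sin (2*c) = -(sin (2*(a+b))) := by
    rw [sin_two_mul, sin_two_mul, h1, h2, neg_neg]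
    linear_combination (-2 * sin (a+b) * cos (a+b)) * hp
  rw [h1, h3, neg_neg]
  simp only [sin_two_mul, sin_add, cos_add]
  have ha := sin_sq_add_cos_sq a
  have hb := sin_sq_add_cos_sq b
  have ha' : cos a ^ 2 = 1 - sin a ^ 2 := by linarith
  have hb' : cos b ^ 2 = 1 - sin b ^ 2 := by linarith
  ring_nf
  simp only [ha', hb']
  ring

/-- The exact finite-`N` umklapp-free symmetry condition (Eq. (3.1.2) of the paper with
truncation length `L = N/2`): the finite-lattice coupling constants
`a_l = π(2 + (−1)^l)/(N·tan(πl/N))` make all three-phonon umklapp coefficients vanish. -/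
theorem stmt_8 (N : ℕ) (hNeven : Even N) (hN : 6 ≤ N) (i j k : ℕ) (h2 : 2 ≤ i) (hij : i ≤ j)
    (hjk : j ≤ k) (hk : k ≤ N / 2 - 1) (hsum : i + j + k = N) :
    ∑ l ∈ Finset.Icc 1 (N / 2 - 1),
      (-1 : ℝ) ^ l * (π * (2 + (-1 : ℝ) ^ l) / (N * Real.tan (π * l / N))) *
        (Real.sin (π * l * i / N) * Real.sin (π * l * j / N) * Real.sin (π * l * k / N)) = 0 := by
  obtain ⟨m, hm⟩ : ∃ m, N = 2 * (m + 1) := by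
    obtain ⟨r, hr⟩ := hNeven
    exact ⟨r - 1, by omega⟩
  have hm' : N / 2 - 1 = m := by omega
  rw [hm'] at hk ⊢
  have hi := fsum_eq m i (by omega) (by omega)
  have hj := fsum_eq m j (by omega) (by omega)
  have hk := fsum_eq m k (by omega) (by omega)
  have hs : (i:ℝ) + j + k = 2 * (m+1) := by exact_mod_cast hsum.trans hm
  have hNr : (N:ℝ) = 2 * (m+1) := by exact_mod_cast hm
  have hmp : (0:ℝ) < m + 1 := by positivity
  have key : fsum m i + fsum m j + fsum m k = 0 := by rw [hi, hj, hk]; linarith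
  rw [← mul_zero (-π / (4 * N)), ← key]
  simp only [fsum, ← Finset.sum_add_distrib, Finset.mul_sum]
  refine Finset.sum_congr rfl fun l hl => ?_
  rw [triple (π * l * i / N) (π * l * j / N) (π * l * k / N) l
    (by rw [← add_div, ← add_div, ← mul_add, ← mul_add, hs, hNr]; field_simp)]
  have e (n : ℕ) : 2 * (π * l * n / N) = l * (π * n / (m+1)) := by rw [hNr]; field_simp
  have e' : π * l / N = l * (π / (2*(m+1))) := by rw [hNr]; field_simp
  have hp : ((-1:ℝ)^l)*((-1:ℝ)^l) = 1 := by rw [← mul_pow]; simp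
  rw [e, e, e, e']
  generalize (-1:ℝ)^l = s at *
  generalize tan (l * (π / (2*(m+1)))) = T
  simp only [div_eq_mul_inv, mul_inv]
  have : s * s = 1 := hp
  generalize sin _ = A1
  generalize sin _ = A2
  generalize sin _ = A3
  linear_combination (-(π * (2+s) * (N:ℝ)⁻¹ * T⁻¹) * 4⁻¹ * (A1 + A2 + A3)) * this
end
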